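/- Let t ∈ (0, n) and λ_t ∈ [0, min(t, n·p⋆)] with t − λ_t ∈ [ n·(α_q(0) − ε²/4), n·(1 − (q/(q−1))·p⋆) ] and n − n·p⋆ − t + λ_t > 0, and let p_t be a real with p_t > p̃_t. Then the suffix error fraction p_h := (n·p − (t − λ_t)·p_t)/(n − n·p⋆ − t + λ_t) satisfies p_h < (q−1)/(2q) − ε²/(9q²) − n·p⋆/(2q·(n − t − n·p⋆ + λ_t)). -/

import Mathlib

/-- The `q`-ary entropy function with the convention `0·log_q 0 = 0`. -/
noncomputable def qEnt (q : ℕ) (x : ℝ) : ℝ :=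
  x * Real.logb q (q - 1) - x * Real.logb q x - (1 - x) * Real.logb q (1 - x)

/-- `α_q(p̄) = 1 − (2q/(q−1))(p−p̄) − (q/(q−1))p⋆`. -/
noncomputable def alphaq (q : ℕ) (p pstar pbar : ℝ) : ℝ :=
  1 - (2 * q / ((q : ℝ) - 1)) * (p - pbar) - ((q : ℝ) / ((q : ℝ) - 1)) * pstar

/-- Bob's guess of random noise `p̄_t`, expressed through `m = t − λ_t`:
`p̄_t = p + p⋆/2 − ((q−1)/(2q))·(1 − m/n)`. -/
noncomputable def pbarT (q : ℕ) (p pstar n m : ℝ) : ℝ :=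
  p + pstar / 2 - (((q : ℝ) - 1) / (2 * q)) * (1 - m / n)

/-- Bob's decoding reference trajectory `p̂_t`, expressed through `m = t − λ_t`:
equal to `ε²/(9q²·α_q(0)²)` for `m < n·α_q(0)` and to
`p̄_t/α_q(p̄_t) + ε²/(9q²·α_q(p̄_t)²)` for `m ≥ n·α_q(0)`. -/
noncomputable def phatT (q : ℕ) (p pstar ε n m : ℝ) : ℝ :=
  if m < n * alphaq q p pstar 0 then
    ε ^ 2 / (9 * (q : ℝ) ^ 2 * (alphaq q p pstar 0) ^ 2)
  else
    pbarT q p pstar n m / alphaq q p pstar (pbarT q p pstar n m) +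
      ε ^ 2 / (9 * (q : ℝ) ^ 2 * (alphaq q p pstar (pbarT q p pstar n m)) ^ 2)

/-- The energy bounding trajectory `p̃_t = p̄_t/α_q(p̄_t) + (n−t)·ε²/(9q²·m)`,
expressed through the position `t` and `m = t − λ_t`. -/
noncomputable def ptildeT (q : ℕ) (p pstar ε n t m : ℝ) : ℝ :=
  pbarT q p pstar n m / alphaq q p pstar (pbarT q p pstar n m) +
    (n - t) * ε ^ 2 / (9 * (q : ℝ) ^ 2 * m)

theorem alphaq_pbarT {q : ℕ} (hq : 2 ≤ q) (p pstar n m : ℝ) :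
    alphaq q p pstar (pbarT q p pstar n m) = m / n := by
  have hq2 : (2 : ℝ) ≤ q := by exact_mod_cast hq
  have h0 : (q : ℝ) ≠ 0 := by linarith
  have h1 : (q : ℝ) - 1 ≠ 0 := by linarith
  unfold alphaq pbarT
  generalize m / n = x
  field_simp
  ring

theorem le_alphaq_zero {q : ℕ} (hq : 2 ≤ q) {p pstar ε : ℝ} (hε : 0 ≤ ε)
    (hsum : 2 * p + pstar + ε ≤ ((q : ℝ) - 1) / q) :
    ε ≤ alphaq q p pstar 0 := by
  have hq2 : (2 : ℝ) ≤ q := by exact_mod_cast hq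
  have h0 : (0 : ℝ) < q := by linarith
  have h1 : (0 : ℝ) < (q : ℝ) - 1 := by linarith
  rw [le_div_iff₀ h0] at hsum
  have h : alphaq q p pstar 0 = ((q : ℝ) - 1 - (2 * p + pstar) * q) / (q - 1) := by
    unfold alphaq
    field_simp
    ring
  rw [h, le_div_iff₀ h1]
  nlinarith

theorem mul_ptildeT {q : ℕ} (hq : 2 ≤ q) (p pstar ε t : ℝ) {n m : ℝ} (hn : 0 < n) (hm : 0 < m) :
    m * ptildeT q p pstar ε n t m =
      n * (p + pstar / 2) - ((q : ℝ) - 1) / (2 * q) * (n - m) +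
        (n - t) * (ε ^ 2 / (9 * (q : ℝ) ^ 2)) := by
  have hq2 : (2 : ℝ) ≤ q := by exact_mod_cast hq
  have h0 : (q : ℝ) ≠ 0 := by linarith
  rw [ptildeT, alphaq_pbarT hq, pbarT]
  field_simp

theorem stmt10 (q : ℕ) (hq : 2 ≤ q) (ε p pstar n : ℝ)
    (hε0 : 0 < ε) (hε1 : ε < 1)
    (hp0 : 0 < p) (hp1 : p < ((q : ℝ) - 1) / (2 * q))
    (hps0 : 0 < pstar) (hps1 : pstar < ((q : ℝ) - 1) / q)
    (hsum : 2 * p + pstar + ε ≤ ((q : ℝ) - 1) / q)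
    (hn : 0 < n)
    (t lam pt : ℝ) (ht0 : 0 < t) (ht1 : t < n)
    (hl0 : 0 ≤ lam) (hl1 : lam ≤ min t (n * pstar))
    (hm : t - lam ∈ Set.Icc (n * (alphaq q p pstar 0 - ε ^ 2 / 4))
      (n * (1 - ((q : ℝ) / ((q : ℝ) - 1)) * pstar)))
    (hpos : 0 < n - n * pstar - t + lam)
    (hpt : pt > ptildeT q p pstar ε n t (t - lam)) :
    (n * p - (t - lam) * pt) / (n - n * pstar - t + lam) <
      ((q : ℝ) - 1) / (2 * q) - ε ^ 2 / (9 * (q : ℝ) ^ 2) -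
        n * pstar / (2 * q * (n - t - n * pstar + lam)) := by
  have hq2 : (2 : ℝ) ≤ q := by exact_mod_cast hq
  have hm0 : 0 < t - lam := by
    refine lt_of_lt_of_le (mul_pos hn ?_) hm.1
    nlinarith [le_alphaq_zero hq hε0.le hsum]
  have hlam : lam ≤ n * pstar := hl1.trans (min_le_right _ _)
  have hkey := mul_lt_mul_of_pos_left hpt hm0
  rw [mul_ptildeT hq p pstar ε t hn hm0] at hkey
  have hθ : 0 ≤ ε ^ 2 / (9 * (q : ℝ) ^ 2) := by positivity
  have hD : n - t - n * pstar + lam = n - n * pstar - t + lam := by ring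
  rw [hD, div_lt_iff₀ hpos]
  have hrhs : (((q : ℝ) - 1) / (2 * q) - ε ^ 2 / (9 * (q : ℝ) ^ 2) -
        n * pstar / (2 * q * (n - n * pstar - t + lam))) * (n - n * pstar - t + lam) =
      ((q : ℝ) - 1) / (2 * q) * (n - (t - lam)) - n * pstar / 2 -
        ε ^ 2 / (9 * (q : ℝ) ^ 2) * (n - n * pstar - t + lam) := by
    have hne := hpos.ne'
    have h0 : (q : ℝ) ≠ 0 := by linarith
    have hm_eq : t - lam = n - n * pstar - (n - n * pstar - t + lam) := by ring
    rw [hm_eq]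
    generalize n - n * pstar - t + lam = D at hne
    field_simp
    ring
  rw [hrhs]
  nlinarith [mul_nonneg hθ (sub_nonneg.mpr hlam)]
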